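/- Let k ≥ 2 and let S be an intersecting set of perfect matchings of K_{2k} with |S| = (2k-3)!!. Then there exists an edge e of K_{2k} such that S = S_e, the set of all perfect matchings of K_{2k} containing e. -/

import Mathlib

/-- A perfect matching of the complete graph `K_{2k}` on vertex set `Fin (2*k)`,
given as a finite set of edges: every edge is a non-loop, and every vertex lies
in exactly one edge of the matching. -/
def IsPM (k : ℕ) (M : Finset (Sym2 (Fin (2 * k)))) : Prop :=
  (∀ e ∈ M, ¬ e.IsDiag) ∧ ∀ v : Fin (2 * k), ∃! e, e ∈ M ∧ v ∈ e

/-- The type of perfect matchings of `K_{2k}`. -/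
abbrev PM (k : ℕ) : Type := {M : Finset (Sym2 (Fin (2 * k))) // IsPM k M}

open Equiv

section PerfectMatchings

variable {V : Type*}

/-- Fixed-point-free involutions of `V`, i.e. perfect matchings of the complete graph on `V`. -/
def FPFInvolution (π : Perm V) : Prop := ∀ v, π (π v) = v ∧ π v ≠ v

namespace FPFInvolution

lemma conj {π : Perm V} (h : FPFInvolution π) (σ : Perm V) : FPFInvolution (σ * π * σ⁻¹) := by
  intro v
  refine ⟨by simp [(h _).1], fun hv => (h (σ⁻¹ v)).2 ?_⟩
  exact Perm.eq_inv_iff_eq.2 hv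

lemma pow_two {π : Perm V} (h : FPFInvolution π) : π ^ 2 = 1 := by
  ext v
  simp [sq, (h v).1]

variable [Fintype V] [DecidableEq V]

lemma iff_cycleType {k : ℕ} (hV : Fintype.card V = 2 * k) (π : Perm V) :
    FPFInvolution π ↔ π.cycleType = Multiset.replicate k 2 := by
  constructor
  · intro h
    have h1 := Perm.cycleType_of_pow_prime_eq_one (p := 2) h.pow_two
    have hs : π.support = Finset.univ := by
      ext v
      simp [(h v).2]
    have h2 := π.sum_cycleType
    rw [hs, Finset.card_univ, hV, h1] at h2
    simp only [Multiset.sum_replicate, smul_eq_mul] at h2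
    rw [h1]
    congr 1
    omega
  · intro h v
    have h2 := π.sum_cycleType
    rw [h] at h2
    simp only [Multiset.sum_replicate, smul_eq_mul] at h2
    have hs : π.support = Finset.univ := by
      rw [← Finset.card_eq_iff_eq_univ]
      omega
    have hsq : π ^ 2 = 1 := by
      rw [Perm.pow_prime_eq_one_iff, h]
      intro c hc
      exact (Multiset.mem_replicate.1 hc).2
    constructor
    · simpa [sq] using congrArg (fun f : Perm V => f v) hsq
    · rw [← Perm.mem_support, hs]
      exact Finset.mem_univ v

lemma exists_conj {k : ℕ} (hV : Fintype.card V = 2 * k) {π ρ : Perm V}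
    (hπ : FPFInvolution π) (hρ : FPFInvolution ρ) : ∃ σ : Perm V, σ * π * σ⁻¹ = ρ := by
  rw [← isConj_iff, Perm.isConj_iff_cycleType_eq, (iff_cycleType hV π).1 hπ,
    (iff_cycleType hV ρ).1 hρ]

open Nat in
open Classical in
lemma card_eq {k : ℕ} (hk : 0 < k) (hV : Fintype.card V = 2 * k) :
    (Finset.univ.filter fun π : Perm V => FPFInvolution π).card = (2 * k - 1)‼ := by
  have h := Perm.card_of_cycleType_mul_eq V (Multiset.replicate k 2)
  rw [if_pos ⟨by simp [hV, mul_comm], fun a ha => (Multiset.mem_replicate.1 ha).2.ge⟩] at h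
  have hf : (Multiset.replicate k 2).toFinset = {2} := by
    rw [Multiset.toFinset_replicate, if_neg hk.ne']
  rw [hf] at h
  simp only [Multiset.sum_replicate, smul_eq_mul, hV, Multiset.prod_replicate,
    Finset.prod_singleton, Multiset.count_replicate_self, mul_comm k 2, Nat.sub_self,
    Nat.factorial_zero, one_mul] at h
  have h2 := factorial_eq_mul_doubleFactorial (2 * k - 1)
  rw [show 2 * k - 1 + 1 = 2 * k by omega, doubleFactorial_two_mul, ← h, mul_comm] at h2
  rw [← Nat.eq_of_mul_eq_mul_left (by positivity) h2]
  congr 1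
  ext π
  simp [iff_cycleType hV]

open Nat in
open Classical in
/-- The number of perfect matchings through a given edge. -/
lemma card_eq_edge {k : ℕ} (hk : 2 ≤ k) (hV : Fintype.card V = 2 * k) {a b : V} (hab : a ≠ b) :
    (Finset.univ.filter fun π : Perm V => FPFInvolution π ∧ π a = b).card = (2 * k - 3)‼ := by
  have h := card_eq (by omega) hV
  have hfib := Finset.card_eq_sum_card_fiberwise
    (s := Finset.univ.filter fun π : Perm V => FPFInvolution π)
    (t := Finset.univ.erase a) (f := fun π => π a) (by
      intro π hπ
      simp only [Finset.coe_filter, Finset.mem_univ, true_and, Set.mem_ofPred_eq] at hπ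
      simp [(hπ a).2])
  have hc : ∀ c ∈ Finset.univ.erase a,
      ((Finset.univ.filter fun π : Perm V => FPFInvolution π).filter fun π => π a = c).card =
      (Finset.univ.filter fun π : Perm V => FPFInvolution π ∧ π a = b).card := by
    intro c hc
    have hca : c ≠ a := Finset.ne_of_mem_erase hc
    refine Finset.card_bij' (fun π _ => swap b c * π * (swap b c)⁻¹)
      (fun π _ => swap b c * π * (swap b c)⁻¹) ?_ ?_ ?_ ?_
    · intro π hπ
      simp only [Finset.mem_filter, Finset.mem_univ, true_and] at hπ ⊢
      refine ⟨hπ.1.conj _, ?_⟩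
      simp [swap_apply_of_ne_of_ne hab hca.symm, hπ.2]
    · intro π hπ
      simp only [Finset.mem_filter, Finset.mem_univ, true_and] at hπ ⊢
      refine ⟨hπ.1.conj _, ?_⟩
      simp [swap_apply_of_ne_of_ne hab hca.symm, hπ.2]
    · intro π _
      simp [mul_assoc]
    · intro π _
      simp [mul_assoc]
  rw [h, Finset.sum_congr rfl hc, Finset.sum_const, Finset.card_erase_of_mem (Finset.mem_univ a),
    Finset.card_univ, hV, smul_eq_mul] at hfib
  have h3 := doubleFactorial_add_two (2 * k - 3)
  rw [show 2 * k - 3 + 2 = 2 * k - 1 by omega, hfib] at h3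
  exact Nat.eq_of_mul_eq_mul_left (by omega) h3

open Classical in
lemma card_conj_eq {k : ℕ} (hV : Fintype.card V = 2 * k) {π ρ π' ρ' : Perm V}
    (hπ : FPFInvolution π) (hρ : FPFInvolution ρ) (hπ' : FPFInvolution π')
    (hρ' : FPFInvolution ρ') :
    (Finset.univ.filter fun σ : Perm V => σ * π * σ⁻¹ = ρ).card =
      (Finset.univ.filter fun σ : Perm V => σ * π' * σ⁻¹ = ρ').card := by
  obtain ⟨s, rfl⟩ := exists_conj hV hπ hπ'
  obtain ⟨t, rfl⟩ := exists_conj hV hρ hρ'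
  refine Finset.card_bij' (fun σ _ => t * σ * s⁻¹) (fun σ _ => t⁻¹ * σ * s) ?_ ?_ ?_ ?_
  · intro σ hσ
    simp only [Finset.mem_filter, Finset.mem_univ, true_and] at hσ ⊢
    rw [← hσ]
    group
  · intro σ hσ
    simp only [Finset.mem_filter, Finset.mem_univ, true_and] at hσ ⊢
    calc t⁻¹ * σ * s * π * (t⁻¹ * σ * s)⁻¹ = t⁻¹ * (σ * (s * π * s⁻¹) * σ⁻¹) * t := by group
      _ = ρ := by rw [hσ]; group
  · intro σ _
    group
  · intro σ _
    group

end FPFInvolution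

/-- A one-factorization of the complete graph on `V`. -/
structure IsOneFactorization {C : Type*} [Fintype C] [Fintype V] (F : C → Perm V) : Prop where
  card : Fintype.card C + 1 = Fintype.card V
  fpf : ∀ c, FPFInvolution (F c)
  inj : ∀ c d v, F c v = F d v → c = d

/-- An intersecting family of perfect matchings. -/
structure IsIntersecting (S : Finset (Perm V)) : Prop where
  fpf : ∀ π ∈ S, FPFInvolution π
  inter : ∀ π ∈ S, ∀ ρ ∈ S, ∃ v, π v = ρ v

lemma IsOneFactorization.conj [Fintype V] {C : Type*} [Fintype C] {F : C → Perm V}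
    (hF : IsOneFactorization F) (σ : Perm V) :
    IsOneFactorization fun c => σ * F c * σ⁻¹ where
  card := hF.card
  fpf c := (hF.fpf c).conj σ
  inj c d v h := hF.inj c d (σ⁻¹ v) (by simpa using h)

/-- Glue two perfect matchings along a set that both preserve. -/
lemma FPFInvolution.exists_glue {π ρ : Perm V} (hπ : FPFInvolution π) (hρ : FPFInvolution ρ)
    {X : Set V} (hX : ∀ v ∈ X, π v ∈ X ∧ ρ v ∈ X) :
    ∃ μ : Perm V, FPFInvolution μ ∧ (∀ v ∈ X, μ v = π v) ∧ ∀ v ∉ X, μ v = ρ v := by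
  classical
  have hX' : ∀ v ∉ X, ρ v ∉ X := fun v hv h => hv (by simpa [(hρ v).1] using (hX _ h).2)
  have hinv : Function.Involutive fun v => if v ∈ X then π v else ρ v := by
    intro v
    by_cases hv : v ∈ X
    · simp [hv, (hX v hv).1, (hπ v).1]
    · simp [hv, hX' v hv, (hρ v).1]
  refine ⟨hinv.toPerm, fun v => ⟨hinv v, ?_⟩, fun v hv => by simp [hv], fun v hv => by simp [hv]⟩
  by_cases hv : v ∈ X
  · simpa [hv] using (hπ v).2
  · simpa [hv] using (hρ v).2

lemma IsOneFactorization.exists_switch [Fintype V] {C : Type*} [Fintype C] [DecidableEq C]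
    {F : C → Perm V} (hF : IsOneFactorization F) {c d : C} {X : Set V}
    (hX : ∀ v ∈ X, F c v ∈ X ∧ F d v ∈ X) :
    ∃ G : C → Perm V, IsOneFactorization G ∧ (∀ e, ∀ v ∈ X, G e v = F (swap c d e) v) ∧
      ∀ e, ∀ v ∉ X, G e v = F e v := by
  obtain ⟨μ, hμ, hμX, hμX'⟩ := (hF.fpf d).exists_glue (hF.fpf c) fun v hv => (hX v hv).symm
  obtain ⟨ν, hν, hνX, hνX'⟩ := (hF.fpf c).exists_glue (hF.fpf d) hX
  let G : C → Perm V := fun e => if e = c then μ else if e = d then ν else F e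
  have hGX : ∀ e, ∀ v ∈ X, G e v = F (swap c d e) v := by
    intro e v hv
    by_cases h1 : e = c
    · simp [G, h1, hμX v hv]
    by_cases h2 : e = d
    · subst h2
      simp [G, h1, hνX v hv]
    · simp [G, h1, h2, swap_apply_of_ne_of_ne h1 h2]
  have hGX' : ∀ e, ∀ v ∉ X, G e v = F e v := by
    intro e v hv
    by_cases h1 : e = c
    · simp [G, h1, hμX' v hv]
    by_cases h2 : e = d
    · subst h2
      simp [G, h1, hνX' v hv]
    · simp [G, h1, h2]
  refine ⟨G, ⟨hF.card, fun e => ?_, fun e e' v h => ?_⟩, hGX, hGX'⟩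
  · by_cases h1 : e = c
    · simpa [G, h1] using hμ
    by_cases h2 : e = d
    · subst h2
      simpa [G, h1] using hν
    · simpa [G, h1, h2] using hF.fpf e
  · by_cases hv : v ∈ X
    · rw [hGX e v hv, hGX e' v hv] at h
      exact (swap c d).injective (hF.inj _ _ v h)
    · rw [hGX' e v hv, hGX' e' v hv] at h
      exact hF.inj _ _ v h

variable [DecidableEq V]

lemma FPFInvolution.swap_conj_self {π : Perm V} (h : FPFInvolution π) (x : V) :
    swap x (π x) * π * (swap x (π x))⁻¹ = π := by
  rw [mul_inv_eq_iff_eq_mul, mul_swap_eq_swap_mul π, (h x).1, swap_comm x]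

/-- The centralizer of a perfect matching moves any vertex to any other. -/
lemma FPFInvolution.exists_centralizing {π : Perm V} (h : FPFInvolution π) (p q : V) :
    ∃ g : Perm V, g * π * g⁻¹ = π ∧ g p = q ∧
      ∀ v, v ≠ p → v ≠ π p → v ≠ q → v ≠ π q → g v = v := by
  by_cases hpq : q = p
  · exact ⟨1, by simp, by simp [hpq], by simp⟩
  by_cases hq : q = π p
  · subst hq
    exact ⟨swap p (π p), h.swap_conj_self p, by simp, fun v h1 h2 _ _ =>
      swap_apply_of_ne_of_ne h1 h2⟩
  · have hpq' : p ≠ π q := fun e => hq (by rw [e, (h q).1])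
    refine ⟨swap p q * swap (π p) (π q), ?_, ?_, ?_⟩
    · have hcomm : swap p q * swap (π p) (π q) = swap (π p) (π q) * swap p q := by
        refine (Perm.Disjoint.commute ?_).eq
        refine Perm.disjoint_swap_swap ?_
        simp [(h p).2.symm, (h q).2.symm, hpq', hq, Ne.symm hpq, π.injective.eq_iff]
      rw [mul_inv_eq_iff_eq_mul, ← mul_assoc π, mul_swap_eq_swap_mul π p q, mul_assoc _ π,
        mul_swap_eq_swap_mul π (π p), (h p).1, (h q).1, ← mul_assoc, hcomm]
    · simp [swap_apply_of_ne_of_ne (h p).2.symm hpq']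
    · intro v h1 h2 h3 h4
      simp [swap_apply_of_ne_of_ne h2 h4, swap_apply_of_ne_of_ne h1 h3]

lemma FPFInvolution.exists_conj_adjust {π₀ π ρ : Perm V} (h : FPFInvolution π)
    (hρ : ρ * π₀ * ρ⁻¹ = π) (p₀ q : V) :
    ∃ ρ' : Perm V, ρ' * π₀ * ρ'⁻¹ = π ∧ ρ' p₀ = q ∧
      ∀ v, v ≠ p₀ → v ≠ π₀ p₀ → ρ v ≠ q → ρ v ≠ π q → ρ' v = ρ v := by
  obtain ⟨g, hg, hgp, hgv⟩ := h.exists_centralizing (ρ p₀) q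
  refine ⟨g * ρ, ?_, hgp, fun v h1 h2 h3 h4 => hgv _ (by simpa using h1) ?_ h3 h4⟩
  · rw [← hg, ← hρ]
    group
  · rw [← hρ]
    simpa using h2

variable [Fintype V]

lemma IsIntersecting.sum_le_one {S : Finset (Perm V)} (hS : IsIntersecting S)
    {C : Type*} [Fintype C] {F : C → Perm V} (hF : IsOneFactorization F) :
    ∑ c, (if F c ∈ S then 1 else 0) ≤ 1 := by
  rw [← Finset.card_filter, Finset.card_le_one]
  intro c hc d hd
  simp only [Finset.mem_filter, Finset.mem_univ, true_and] at hc hd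
  obtain ⟨v, hv⟩ := hS.inter _ hc _ hd
  exact hF.inj c d v hv

open Nat in
/-- An intersecting family of the maximum size meets every one-factorization in exactly one
perfect matching. -/
lemma IsIntersecting.sum_eq_one {k : ℕ} (hk : 2 ≤ k) (hV : Fintype.card V = 2 * k)
    {S : Finset (Perm V)} (hS : IsIntersecting S) (hcard : S.card = (2 * k - 3)‼)
    {C : Type*} [Fintype C] {F : C → Perm V} (hF : IsOneFactorization F) :
    ∑ c, (if F c ∈ S then 1 else 0) = 1 := by
  classical
  have hle : ∀ σ ∈ (Finset.univ : Finset (Perm V)),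
      ∑ c, (if σ * F c * σ⁻¹ ∈ S then 1 else 0) ≤ 1 :=
    fun σ _ => hS.sum_le_one (hF.conj σ)
  have hC : Fintype.card C = 2 * k - 1 := by have := hF.card; omega
  have : Nonempty C := Fintype.card_pos_iff.1 (by omega)
  let c₀ : C := Classical.arbitrary C
  set h := (Finset.univ.filter fun σ : Perm V => σ * F c₀ * σ⁻¹ = F c₀).card with hh
  have hconst : ∀ c ρ, FPFInvolution ρ →
      (Finset.univ.filter fun σ : Perm V => σ * F c * σ⁻¹ = ρ).card = h := fun c ρ hρ =>
    FPFInvolution.card_conj_eq hV (hF.fpf c) hρ (hF.fpf c₀) (hF.fpf c₀)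
  have htot : Fintype.card (Perm V) = (2 * k - 1)‼ * h := by
    rw [← Finset.card_univ, Finset.card_eq_sum_card_fiberwise
      (t := Finset.univ.filter fun π : Perm V => FPFInvolution π)
      (f := fun σ : Perm V => σ * F c₀ * σ⁻¹)
      (by intro σ _; simpa using (hF.fpf c₀).conj σ)]
    rw [Finset.sum_congr rfl fun ρ hρ => hconst c₀ ρ (Finset.mem_filter.1 hρ).2,
      Finset.sum_const, FPFInvolution.card_eq (by omega) hV, smul_eq_mul]
  have hfac : ∀ c, ∑ σ : Perm V, (if σ * F c * σ⁻¹ ∈ S then 1 else 0) = S.card * h := by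
    intro c
    rw [← Finset.card_filter, Finset.card_eq_sum_card_fiberwise (t := S)
      (f := fun σ : Perm V => σ * F c * σ⁻¹) (by intro σ hσ; simpa using hσ)]
    rw [Finset.sum_congr rfl (g := fun _ => h), Finset.sum_const, smul_eq_mul]
    intro ρ hρ
    rw [← hconst c ρ (hS.fpf ρ hρ), Finset.filter_filter]
    congr 1
    ext σ
    simp only [Finset.mem_filter, Finset.mem_univ, true_and, and_iff_right_iff_imp]
    rintro rfl
    exact hρ
  have hsum : ∑ σ : Perm V, ∑ c, (if σ * F c * σ⁻¹ ∈ S then 1 else 0) = ∑ _σ : Perm V, 1 := by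
    rw [Finset.sum_comm, Finset.sum_congr rfl fun c _ => hfac c, Finset.sum_const,
      Finset.sum_const, Finset.card_univ, Finset.card_univ, htot, hC, hcard, smul_eq_mul,
      smul_eq_mul, mul_one]
    have h3 := doubleFactorial_add_two (2 * k - 3)
    rw [show 2 * k - 3 + 2 = 2 * k - 1 by omega] at h3
    rw [h3]
    ring
  have := (Finset.sum_eq_sum_iff_of_le hle).1 hsum 1 (Finset.mem_univ _)
  simpa using this

/-- Any two perfect matchings with four marked edges are equivalent under relabelling. -/
lemma FPFInvolution.exists_conj_of_four {k : ℕ} (hV : Fintype.card V = 2 * k) {π₀ π : Perm V}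
    (h₀ : FPFInvolution π₀) (h : FPFInvolution π) {z₀ w₀ x₀ y₀ z w x y : V}
    (hw₀ : z₀ ≠ w₀ ∧ z₀ ≠ π₀ w₀) (hx₀ : z₀ ≠ x₀ ∧ z₀ ≠ π₀ x₀ ∧ w₀ ≠ x₀ ∧ w₀ ≠ π₀ x₀)
    (hy₀ : z₀ ≠ y₀ ∧ z₀ ≠ π₀ y₀ ∧ w₀ ≠ y₀ ∧ w₀ ≠ π₀ y₀ ∧ x₀ ≠ y₀ ∧ x₀ ≠ π₀ y₀)
    (hw : z ≠ w ∧ z ≠ π w) (hx : z ≠ x ∧ z ≠ π x ∧ w ≠ x ∧ w ≠ π x)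
    (hy : z ≠ y ∧ z ≠ π y ∧ w ≠ y ∧ w ≠ π y ∧ x ≠ y ∧ x ≠ π y) :
    ∃ ρ : Perm V, ρ * π₀ * ρ⁻¹ = π ∧ ρ z₀ = z ∧ ρ w₀ = w ∧ ρ x₀ = x ∧ ρ y₀ = y := by
  obtain ⟨ρ₀, hρ₀⟩ := exists_conj hV h₀ h
  obtain ⟨ρ₁, hρ₁, h1z, -⟩ := h.exists_conj_adjust hρ₀ z₀ z
  obtain ⟨ρ₂, hρ₂, h2w, h2⟩ := h.exists_conj_adjust hρ₁ w₀ w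
  have h2z : ρ₂ z₀ = z := by rw [h2 z₀, h1z] <;> simp_all
  obtain ⟨ρ₃, hρ₃, h3x, h3⟩ := h.exists_conj_adjust hρ₂ x₀ x
  have h3z : ρ₃ z₀ = z := by rw [h3 z₀, h2z] <;> simp_all
  have h3w : ρ₃ w₀ = w := by rw [h3 w₀, h2w] <;> simp_all
  obtain ⟨ρ₄, hρ₄, h4y, h4⟩ := h.exists_conj_adjust hρ₃ y₀ y
  refine ⟨ρ₄, hρ₄, ?_, ?_, ?_, h4y⟩
  · rw [h4 z₀, h3z] <;> simp_all
  · rw [h4 w₀, h3w] <;> simp_all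
  · rw [h4 x₀, h3x] <;> simp_all

/-- A one-factorization of the complete graph on `V` two of whose members have a disconnected
union. -/
def HasSplitFactorization (V : Type*) [Fintype V] : Prop :=
  ∃ (C : Type) (_ : Fintype C) (F : C → Perm V) (c d : C) (X : Set V),
    IsOneFactorization F ∧ c ≠ d ∧ (∀ v ∈ X, F c v ∈ X ∧ F d v ∈ X) ∧ X.Nonempty ∧ Xᶜ.Nonempty

/-- Membership in a maximum intersecting family is additive over independent switches. -/
lemma IsIntersecting.exchange {k : ℕ} (hk : 2 ≤ k) (hV : Fintype.card V = 2 * k)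
    (hsplit : HasSplitFactorization V)
    {S : Finset (Perm V)} (hS : IsIntersecting S)
    (hcard : S.card = Nat.doubleFactorial (2 * k - 3))
    {π : Perm V} (h : FPFInvolution π) {z w x y : V}
    (hw : z ≠ w ∧ z ≠ π w) (hx : z ≠ x ∧ z ≠ π x ∧ w ≠ x ∧ w ≠ π x)
    (hy : z ≠ y ∧ z ≠ π y ∧ w ≠ y ∧ w ≠ π y ∧ x ≠ y ∧ x ≠ π y) :
    ((if π ∈ S then 1 else 0) +
      if (swap z w * swap x y) * π * (swap z w * swap x y)⁻¹ ∈ S then 1 else 0) =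
    (if swap z w * π * (swap z w)⁻¹ ∈ S then 1 else 0) +
      if swap x y * π * (swap x y)⁻¹ ∈ S then 1 else 0 := by
  classical
  obtain ⟨C, _, F, c, d, X, hF, hcd, hX, ⟨z₀, hz₀⟩, ⟨x₀, hx₀⟩⟩ := hsplit
  obtain ⟨G, hG, hGX, hGX'⟩ := hF.exists_switch hX
  set f : Perm V → ℕ := fun π => if π ∈ S then 1 else 0 with hf
  have hrest : ∀ e, e ≠ c → e ≠ d → G e = F e := by
    intro e h1 h2
    ext v
    by_cases hv : v ∈ X
    · rw [hGX e v hv, swap_apply_of_ne_of_ne h1 h2]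
    · rw [hGX' e v hv]
  have hrel : ∀ σ : Perm V, f (σ * F c * σ⁻¹) + f (σ * F d * σ⁻¹) =
      f (σ * G c * σ⁻¹) + f (σ * G d * σ⁻¹) := by
    intro σ
    have h1 : ∑ e, f (σ * F e * σ⁻¹) = 1 := hS.sum_eq_one hk hV hcard (hF.conj σ)
    have h2 : ∑ e, f (σ * G e * σ⁻¹) = 1 := hS.sum_eq_one hk hV hcard (hG.conj σ)
    have hd : d ∈ Finset.univ.erase c := by simp [hcd.symm]
    rw [← Finset.add_sum_erase _ _ (Finset.mem_univ c), ← Finset.add_sum_erase _ _ hd] at h1 h2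
    have h3 : ∑ e ∈ (Finset.univ.erase c).erase d, f (σ * G e * σ⁻¹) =
        ∑ e ∈ (Finset.univ.erase c).erase d, f (σ * F e * σ⁻¹) := by
      refine Finset.sum_congr rfl fun e he => ?_
      simp only [Finset.mem_erase, Finset.mem_univ, and_true] at he
      rw [hrest e he.2 he.1]
    omega
  set w₀ := F c z₀
  set y₀ := F c x₀
  have hs : swap z₀ w₀ * F c * (swap z₀ w₀)⁻¹ = F c := (hF.fpf c).swap_conj_self z₀
  have ht : swap x₀ y₀ * F c * (swap x₀ y₀)⁻¹ = F c := (hF.fpf c).swap_conj_self x₀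
  have hsν : swap z₀ w₀ * G d * (swap z₀ w₀)⁻¹ = G d := by
    have : w₀ = G d z₀ := by rw [hGX d z₀ hz₀]; simp [w₀]
    rw [this]
    exact (hG.fpf d).swap_conj_self z₀
  have htμ : swap x₀ y₀ * G c * (swap x₀ y₀)⁻¹ = G c := by
    have : y₀ = G c x₀ := (hGX' c x₀ hx₀).symm
    rw [this]
    exact (hG.fpf c).swap_conj_self x₀
  have hX' : ∀ v ∉ X, F c v ∉ X ∧ F d v ∉ X := fun v hv =>
    ⟨fun h => hv (by simpa [(hF.fpf c v).1] using (hX _ h).1),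
      fun h => hv (by simpa [(hF.fpf d v).1] using (hX _ h).2)⟩
  have hw₀ : w₀ ∈ X := (hX _ hz₀).1
  have hy₀ : y₀ ∉ X := (hX' _ hx₀).1
  have hne : ∀ u ∈ X, ∀ v ∉ X, u ≠ v := fun u hu v hv e => hv (e ▸ hu)
  have hFne : ∀ v, v ≠ F d (F c v) := by
    intro v e
    have : F c (F c v) = F d (F c v) := by rw [← e, (hF.fpf c v).1]
    exact hcd (hF.inj c d _ this)
  obtain ⟨ρ, hρ, rfl, rfl, rfl, rfl⟩ := FPFInvolution.exists_conj_of_four hV (hF.fpf d) h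
    (z₀ := z₀) (w₀ := w₀) (x₀ := x₀) (y₀ := y₀)
    ⟨(hF.fpf c z₀).2.symm, hFne z₀⟩
    ⟨hne _ hz₀ _ hx₀, hne _ hz₀ _ (hX' _ hx₀).2, hne _ hw₀ _ hx₀, hne _ hw₀ _ (hX' _ hx₀).2⟩
    ⟨hne _ hz₀ _ hy₀, hne _ hz₀ _ (hX' _ hy₀).2, hne _ hw₀ _ hy₀, hne _ hw₀ _ (hX' _ hy₀).2,
      (hF.fpf c x₀).2.symm, hFne x₀⟩ hw hx hy
  have hconj : ∀ (σ τ κ : Perm V), (σ * τ) * κ * (σ * τ)⁻¹ = σ * (τ * κ * τ⁻¹) * σ⁻¹ := by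
    intro σ τ κ
    group
  have hst : swap z₀ w₀ * swap x₀ y₀ = swap x₀ y₀ * swap z₀ w₀ := by
    refine (Perm.Disjoint.commute (Perm.disjoint_swap_swap ?_)).eq
    simp [hne _ hz₀ _ hx₀, hne _ hz₀ _ hy₀, hne _ hw₀ _ hx₀, hne _ hw₀ _ hy₀,
      (hF.fpf c z₀).2.symm, (hF.fpf c x₀).2.symm, w₀, y₀]
  have r1 := hrel ρ
  have r2 := hrel (ρ * swap z₀ w₀)
  have r3 := hrel (ρ * swap x₀ y₀)
  have r4 := hrel (ρ * (swap z₀ w₀ * swap x₀ y₀))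
  simp only [hconj] at r1 r2 r3 r4
  rw [hs, hsν] at r2
  rw [ht, htμ] at r3
  rw [ht, hs, htμ, ← hconj (swap z₀ w₀) (swap x₀ y₀) (G d), hst,
    hconj (swap x₀ y₀) (swap z₀ w₀) (G d), hsν] at r4
  have hmove : ∀ σ : Perm V, (ρ * σ * ρ⁻¹) * π * (ρ * σ * ρ⁻¹)⁻¹ = ρ * (σ * F d * σ⁻¹) * ρ⁻¹ := by
    intro σ
    rw [← hρ]
    group
  have hsw : ∀ a b, swap (ρ a) (ρ b) = ρ * swap a b * ρ⁻¹ := fun a b => by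
    rw [mul_swap_eq_swap_mul]; group
  have hsw2 : swap (ρ z₀) (ρ w₀) * swap (ρ x₀) (ρ y₀) =
      ρ * (swap z₀ w₀ * swap x₀ y₀) * ρ⁻¹ := by
    rw [hsw, hsw]; group
  change f π + f _ = f _ + f _
  rw [hsw2, hmove, hsw, hsw, hmove, hmove, ← hρ, hconj]
  omega

/-- The edges of the perfect matching given by an involution. -/
def edgesOf {V : Type*} (π : Perm V) : Set (Sym2 V) := Set.range fun v => s(v, π v)

lemma FPFInvolution.mk_mem_edgesOf {V : Type*} {π : Perm V} (h : FPFInvolution π) {a b : V} :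
    s(a, b) ∈ edgesOf π ↔ π a = b := by
  constructor
  · rintro ⟨v, hv⟩
    rcases Sym2.eq_iff.1 hv with ⟨rfl, rfl⟩ | ⟨rfl, rfl⟩
    · rfl
    · exact (h v).1
  · rintro rfl
    exact ⟨a, rfl⟩

/-- Replace the edges of `π` at `a` and `b` by interchanging the roles of `a` and `b`. -/
def switch {V : Type*} [DecidableEq V] (a b : V) (π : Perm V) : Perm V :=
  swap a b * π * (swap a b)⁻¹

lemma switch_apply {V : Type*} [DecidableEq V] {a b : V} {π : Perm V} (h : FPFInvolution π)
    (hab : a ≠ b) (hb : b ≠ π a) (v : V) :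
    switch a b π v = if v = a then π b else if v = b then π a else if v = π a then b else
      if v = π b then a else π v := by
  have ha : a ≠ π b := fun e => hb (by rw [e, (h b).1])
  have e1 := h a
  have e2 := h b
  have e3 := h v
  simp only [switch, Perm.coe_mul, Function.comp_apply, swap_inv, swap_apply_def]
  grind

lemma FPFInvolution.conj_swap {V : Type*} [DecidableEq V] {π : Perm V} (h : FPFInvolution π)
    (a b : V) : FPFInvolution (switch a b π) := h.conj _

/-- One switch brings `π` closer to `ρ`, keeping all common edges. -/
lemma switch_toward {V : Type*} [DecidableEq V] {π ρ : Perm V} (hπ : FPFInvolution π)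
    (hρ : FPFInvolution ρ) {v : V} (hv : π v ≠ ρ v) :
    (switch (π v) (ρ v) π) v = ρ v ∧
      ∀ u, π u = ρ u → (switch (π v) (ρ v) π) u = ρ u ∧
        u ≠ π v ∧ u ≠ ρ v ∧ u ≠ v ∧ u ≠ π (ρ v) := by
  have hb : ρ v ≠ π (π v) := by rw [(hπ v).1]; exact (hρ v).2
  have e1 := hπ v
  have e2 := hρ v
  have e3 := hπ (ρ v)
  constructor
  · rw [switch_apply hπ hv hb]
    grind
  · intro u hu
    have e4 := hπ u
    have e5 := hρ u
    have e6 := hρ (π v)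
    have n1 : u ≠ v := by grind
    have n2 : u ≠ π v := by grind
    have n3 : u ≠ ρ v := by grind
    have n4 : u ≠ π (ρ v) := by grind
    refine ⟨?_, n2, n3, n1, n4⟩
    rw [switch_apply hπ hv hb]
    grind

lemma switch_induction {ρ : Perm V} (hρ : FPFInvolution ρ) (P : Perm V → Prop)
    (step : ∀ π v, FPFInvolution π → π v ≠ ρ v → P π → P (switch (π v) (ρ v) π)) :
    ∀ π, FPFInvolution π → P π → P ρ := by
  suffices H : ∀ n π, (Finset.univ.filter fun u => π u ≠ ρ u).card = n →
      FPFInvolution π → P π → P ρ from fun π => H _ π rfl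
  intro n
  induction n using Nat.strong_induction_on with
  | _ n ih =>
    intro π hn hπ hP
    by_cases hall : ∀ v, π v = ρ v
    · rwa [← Equiv.ext hall]
    push Not at hall
    obtain ⟨v, hv⟩ := hall
    obtain ⟨h1, h2⟩ := switch_toward hπ hρ hv
    refine ih _ ?_ _ rfl (hπ.conj_swap _ _) (step π v hπ hv hP)
    rw [← hn]
    refine Finset.card_lt_card ⟨fun u => ?_, fun hsub => ?_⟩
    · simp only [Finset.mem_filter, Finset.mem_univ, true_and]
      exact fun hu e => hu (h2 u e).1
    · have := hsub (show v ∈ _ by simpa using hv)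
      simp [h1] at this

/-- A perfect matching can be altered off a small set so as to avoid a given one there. -/
lemma FPFInvolution.exists_avoiding {k : ℕ} (hk : 4 ≤ k) (hV : Fintype.card V = 2 * k)
    {ρ : Perm V} (hρ : FPFInvolution ρ) {X : Finset V} (hX : X.card ≤ 4) :
    ∀ π : Perm V, FPFInvolution π → (∀ v ∈ X, π v ∈ X) →
      ∃ μ : Perm V, FPFInvolution μ ∧ (∀ v ∈ X, μ v = π v) ∧ ∀ v ∉ X, μ v ≠ ρ v := by
  suffices H : ∀ n, ∀ π : Perm V, (Finset.univ.filter fun u => u ∉ X ∧ π u = ρ u).card = n →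
      FPFInvolution π → (∀ v ∈ X, π v ∈ X) →
      ∃ μ : Perm V, FPFInvolution μ ∧ (∀ v ∈ X, μ v = π v) ∧ ∀ v ∉ X, μ v ≠ ρ v from
    fun π => H _ π rfl
  intro n
  induction n using Nat.strong_induction_on with
  | _ n ih =>
    intro π hn hπ hπX
    by_cases hall : ∀ v ∉ X, π v ≠ ρ v
    · exact ⟨π, hπ, fun _ _ => rfl, hall⟩
    push Not at hall
    obtain ⟨v, hvX, hv⟩ := hall
    obtain ⟨y, hy⟩ : ∃ y, y ∉ X ∪ {v, π v} := by
      by_contra! hcon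
      have h1 : X ∪ {v, π v} = Finset.univ := by ext u; simpa using hcon u
      have h2 := Finset.card_union_le X {v, π v}
      have h3 : ({v, π v} : Finset V).card ≤ 2 := Finset.card_le_two
      rw [h1, Finset.card_univ, hV] at h2
      omega
    simp only [Finset.mem_union, Finset.mem_insert, Finset.mem_singleton, not_or] at hy
    obtain ⟨hyX, hyv, hyπ⟩ := hy
    have e1 := hπ v
    have e2 := hρ v
    have e3 := hπ y
    have e4 := hρ y
    have e5 := hρ (π y)
    have hvX' : π v ∉ X := fun h => hvX (by simpa [e1.1] using hπX _ h)
    have hyX' : π y ∉ X := fun h => hyX (by simpa [e3.1] using hπX _ h)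
    have happ := switch_apply hπ (a := π v) (b := y) (Ne.symm hyπ) (by rw [e1.1]; exact hyv)
    have hX' : ∀ u ∈ X, switch (π v) y π u = π u := by
      intro u hu
      have n1 : u ≠ v := fun e => hvX (e ▸ hu)
      have n2 : u ≠ π v := fun e => hvX' (e ▸ hu)
      have n3 : u ≠ y := fun e => hyX (e ▸ hu)
      have n4 : u ≠ π y := fun e => hyX' (e ▸ hu)
      rw [happ, e1.1]
      simp [n1, n2, n3, n4]
    have hagree : ∀ u, switch (π v) y π u = ρ u → π u = ρ u ∧ u ≠ v := by
      intro u hu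
      rw [happ, e1.1] at hu
      grind
    have hlt : (Finset.univ.filter fun u => u ∉ X ∧ switch (π v) y π u = ρ u).card < n := by
      rw [← hn]
      refine Finset.card_lt_card ⟨fun u => ?_, fun hsub => ?_⟩
      · simp only [Finset.mem_filter, Finset.mem_univ, true_and]
        exact fun hu => ⟨hu.1, (hagree u hu.2).1⟩
      · have := hsub (show v ∈ _ by simpa using ⟨hvX, hv⟩)
        simp only [Finset.mem_filter, Finset.mem_univ, true_and] at this
        exact (hagree v this.2).2 rfl
    obtain ⟨μ, h1, h2, h3⟩ := ih _ hlt _ rfl (hπ.conj_swap (π v) y)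
      (fun u hu => by rw [hX' u hu]; exact hπX u hu)
    exact ⟨μ, h1, fun u hu => by rw [h2 u hu, hX' u hu], h3⟩

/-- The version of `exists_avoiding` in terms of edges. -/
lemma FPFInvolution.exists_avoiding_edges {k : ℕ} (hk : 4 ≤ k) (hV : Fintype.card V = 2 * k)
    {π ρ : Perm V} (hπ : FPFInvolution π) (hρ : FPFInvolution ρ) {e g : Sym2 V}
    (he : e ∈ edgesOf π) (hg : g ∈ edgesOf π) :
    ∃ μ : Perm V, FPFInvolution μ ∧ e ∈ edgesOf μ ∧ g ∈ edgesOf μ ∧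
      ∀ h ∈ edgesOf μ, h ∈ edgesOf ρ → h = e ∨ h = g := by
  obtain ⟨a, rfl⟩ := he
  obtain ⟨b, rfl⟩ := hg
  obtain ⟨μ, hμ, hμX, hμX'⟩ := exists_avoiding hk hV hρ (X := {a, π a, b, π b})
    Finset.card_le_four π hπ (by simp [(hπ _).1])
  have ha := hμX a (by simp)
  have hb := hμX b (by simp)
  refine ⟨μ, hμ, hμ.mk_mem_edgesOf.2 ha, hμ.mk_mem_edgesOf.2 hb, ?_⟩
  rintro _ ⟨u, rfl⟩ hu
  have hu' := hρ.mk_mem_edgesOf.1 hu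
  have huX : u ∈ ({a, π a, b, π b} : Finset V) := by
    by_contra hcon
    exact hμX' u hcon hu'.symm
  have := hμX u huX
  simp only [Finset.mem_insert, Finset.mem_singleton] at huX
  rcases huX with rfl | rfl | rfl | rfl
  · left
    beta_reduce
    rw [this]
  · left
    beta_reduce
    rw [this, (hπ a).1, Sym2.eq_swap]
  · right
    beta_reduce
    rw [this]
  · right
    beta_reduce
    rw [this, (hπ b).1, Sym2.eq_swap]

/-- Two edges controlling membership in `S`. -/
structure IsPivot {V : Type*} (S : Finset (Perm V)) (e g : Sym2 V) : Prop where
  ne : e ≠ g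
  exists_mem : ∃ π, FPFInvolution π ∧ e ∈ edgesOf π ∧ g ∈ edgesOf π
  mem : ∀ π, FPFInvolution π → e ∈ edgesOf π → g ∈ edgesOf π → π ∈ S
  mem_or : ∀ π ∈ S, e ∈ edgesOf π ∨ g ∈ edgesOf π

lemma IsPivot.symm {V : Type*} {S : Finset (Perm V)} {e g : Sym2 V} (h : IsPivot S e g) :
    IsPivot S g e where
  ne := h.ne.symm
  exists_mem := let ⟨π, h1, h2, h3⟩ := h.exists_mem; ⟨π, h1, h3, h2⟩
  mem π h1 h2 h3 := h.mem π h1 h3 h2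
  mem_or π hπ := (h.mem_or π hπ).symm

variable {S : Finset (Perm V)}

lemma IsIntersecting.isPivot_of_switch {k : ℕ} (hk : 4 ≤ k) (hV : Fintype.card V = 2 * k)
    (hsplit : HasSplitFactorization V) (hS : IsIntersecting S)
    (hcard : S.card = Nat.doubleFactorial (2 * k - 3))
    {π : Perm V} (hπ : FPFInvolution π) (hπS : π ∈ S) {a b : V} (hab : a ≠ b) (hb : b ≠ π a)
    (hsw : switch a b π ∉ S) : IsPivot S s(a, π a) s(b, π b) := by
  have hmem : ∀ ρ, FPFInvolution ρ → s(a, π a) ∈ edgesOf ρ → s(b, π b) ∈ edgesOf ρ → ρ ∈ S := by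
    intro ρ hρ ha' hb'
    rw [hρ.mk_mem_edgesOf] at ha' hb'
    refine (switch_induction hρ
      (fun μ => μ a = π a ∧ μ b = π b ∧ μ ∈ S ∧ switch a b μ ∉ S) ?_ π hπ
      ⟨rfl, rfl, hπS, hsw⟩).2.2.1
    rintro μ v hμ hv ⟨h1, h2, h3, h4⟩
    obtain ⟨-, hpres⟩ := switch_toward hμ hρ hv
    obtain ⟨pa, a1, a2, a3, a4⟩ := hpres a (by rw [h1, ha'])
    obtain ⟨pb, b1, b2, b3, b4⟩ := hpres b (by rw [h2, hb'])
    have hex := hS.exchange (by omega) hV hsplit hcard hμ (z := a) (w := b) (x := μ v)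
      (y := ρ v) ⟨hab, by rw [h2]; rintro rfl; exact hb (hπ b).1.symm⟩
      ⟨a1, by rwa [(hμ v).1], b1, by rwa [(hμ v).1]⟩
      ⟨a2, a4, b2, b4, hv, by rw [μ.injective.ne_iff]; exact (hρ v).2.symm⟩
    have hcomb : (swap a b * swap (μ v) (ρ v)) * μ * (swap a b * swap (μ v) (ρ v))⁻¹ =
        switch a b (switch (μ v) (ρ v) μ) := by
      simp only [switch]
      group
    change (_ + if _ ∈ S then 1 else 0) = (if switch a b μ ∈ S then 1 else 0) +
      if switch (μ v) (ρ v) μ ∈ S then 1 else 0 at hex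
    rw [hcomb, if_pos h3, if_neg h4] at hex
    refine ⟨by rw [pa, ha'], by rw [pb, hb'], ?_, ?_⟩
    · by_contra hcon
      rw [if_neg hcon] at hex
      omega
    · intro hcon
      rw [if_pos hcon] at hex
      split_ifs at hex <;> omega
  refine ⟨?_, ⟨π, hπ, ⟨a, rfl⟩, ⟨b, rfl⟩⟩, hmem, ?_⟩
  · intro h
    rcases Sym2.eq_iff.1 h with ⟨h1, -⟩ | ⟨-, h2⟩
    · exact hab h1
    · exact hb h2.symm
  · intro ρ hρ
    by_contra! hcon
    obtain ⟨μ, hμ, h1, h2, h3⟩ := hπ.exists_avoiding_edges hk hV (hS.fpf ρ hρ)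
      (e := s(a, π a)) (g := s(b, π b)) ⟨a, rfl⟩ ⟨b, rfl⟩
    obtain ⟨v, hv⟩ := hS.inter μ (hmem μ hμ h1 h2) ρ hρ
    have hvρ : s(v, μ v) ∈ edgesOf ρ := ⟨v, by simp [hv]⟩
    rcases h3 _ ⟨v, rfl⟩ hvρ with h | h
    · exact hcon.1 (h ▸ hvρ)
    · exact hcon.2 (h ▸ hvρ)

lemma IsPivot.inter {k : ℕ} (hk : 4 ≤ k) (hV : Fintype.card V = 2 * k) {e g e' g' : Sym2 V}
    (h : IsPivot S e g) (h' : IsPivot S e' g') : e = e' ∨ e = g' ∨ g = e' ∨ g = g' := by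
  obtain ⟨π, hπ, he, hg⟩ := h.exists_mem
  obtain ⟨π', hπ', he', hg'⟩ := h'.exists_mem
  obtain ⟨μ, hμ, h1, h2, h3⟩ := hπ'.exists_avoiding_edges hk hV hπ he' hg'
  rcases h.mem_or μ (h'.mem μ hμ h1 h2) with hm | hm
  · rcases h3 _ hm he with h | h <;> simp [h]
  · rcases h3 _ hm hg with h | h <;> simp [h]

/-- A pivot separates any member from any non-member, among matchings through a common edge. -/
lemma IsIntersecting.exists_isPivot {k : ℕ} (hk : 4 ≤ k) (hV : Fintype.card V = 2 * k)
    (hsplit : HasSplitFactorization V) (hS : IsIntersecting S)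
    (hcard : S.card = Nat.doubleFactorial (2 * k - 3))
    {π ρ : Perm V} (hπS : π ∈ S) (hρ : FPFInvolution ρ) (hρS : ρ ∉ S) :
    ∃ e g, IsPivot S e g ∧ ∀ h ∈ edgesOf π, h ∈ edgesOf ρ → h ≠ e ∧ h ≠ g := by
  by_contra! hcon
  refine hρS (switch_induction hρ (fun μ => μ ∈ S ∧ ∀ u, π u = ρ u → μ u = ρ u) ?_ π
    (hS.fpf π hπS) ⟨hπS, fun u hu => hu⟩).1
  rintro μ v hμ hv ⟨hμS, hμρ⟩
  obtain ⟨-, hpres⟩ := switch_toward hμ hρ hv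
  refine ⟨?_, fun u hu => (hpres u (hμρ u hu)).1⟩
  by_contra hsw
  have hpiv := hS.isPivot_of_switch hk hV hsplit hcard hμ hμS hv
    (by rw [(hμ v).1]; exact (hρ v).2) hsw
  obtain ⟨_, ⟨u, rfl⟩, huρ, hu⟩ := hcon _ _ hpiv
  have hu' : π u = ρ u := (hρ.mk_mem_edgesOf.1 huρ).symm
  obtain ⟨-, n1, n2, n3, n4⟩ := hpres u (hμρ u hu')
  by_cases hc : s(u, π u) = s(μ v, μ (μ v))
  · rcases Sym2.eq_iff.1 hc with ⟨h, -⟩ | ⟨h, -⟩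
    · exact n1 h
    · exact n3 (by rw [h, (hμ v).1])
  · rcases Sym2.eq_iff.1 (hu hc) with ⟨h, -⟩ | ⟨h, -⟩
    · exact n2 h
    · exact n4 h

lemma FPFInvolution.exists_switch_avoiding {k : ℕ} (hk : 4 ≤ k) (hV : Fintype.card V = 2 * k)
    {π : Perm V} (hπ : FPFInvolution π) {e g h : Sym2 V} (he : e ∈ edgesOf π)
    (hg : g ∈ edgesOf π) (heg : e ≠ g) (hh : h ∉ edgesOf π) :
    ∃ a b, a ≠ b ∧ b ≠ π a ∧ s(a, π a) = g ∧ s(b, π b) ≠ e ∧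
      g ∉ edgesOf (switch a b π) ∧ h ∉ edgesOf (switch a b π) := by
  obtain ⟨p, rfl⟩ := he
  obtain ⟨a, rfl⟩ := hg
  obtain ⟨x, hx⟩ : ∃ x, x ∉ ({p, π p, a, π a} : Finset V) := by
    by_contra! hcon
    have h1 : ({p, π p, a, π a} : Finset V) = Finset.univ := by ext u; simpa using hcon u
    have h2 : ({p, π p, a, π a} : Finset V).card ≤ 4 := Finset.card_le_four
    rw [h1, Finset.card_univ, hV] at h2
    omega
  simp only [Finset.mem_insert, Finset.mem_singleton, not_or] at hx
  obtain ⟨x1, x2, x3, x4⟩ := hx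
  have ea := hπ a
  have ex := hπ x
  have ep := hπ p
  have key : ∀ b, b ≠ a → b ≠ π a → b ≠ p → b ≠ π p → h ∉ edgesOf (switch a b π) →
      ∃ a' b, a' ≠ b ∧ b ≠ π a' ∧ s(a', π a') = s(a, π a) ∧ s(b, π b) ≠ s(p, π p) ∧
      s(a, π a) ∉ edgesOf (switch a' b π) ∧ h ∉ edgesOf (switch a' b π) := by
    intro b b1 b2 b3 b4 hb
    refine ⟨a, b, b1.symm, b2, rfl, ?_, ?_, hb⟩
    · intro hc
      rcases Sym2.eq_iff.1 hc with ⟨h, -⟩ | ⟨h, -⟩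
      · exact b3 h
      · exact b4 h
    · rw [(hπ.conj_swap a b).mk_mem_edgesOf, switch_apply hπ b1.symm b2, if_pos rfl]
      exact fun hc => b1 (π.injective hc)
  by_cases hc : h ∈ edgesOf (switch a x π)
  · refine key (π x) (by grind) (by grind) (by grind) (by grind) fun hc' => ?_
    obtain ⟨u, rfl⟩ := hc
    have hu := (hπ.conj_swap a (π x)).mk_mem_edgesOf.1 hc'
    have hu' : π u ≠ switch a x π u := fun e => hh (hπ.mk_mem_edgesOf.2 e)
    rw [switch_apply hπ (Ne.symm x3) x4] at hu hu'
    rw [switch_apply hπ (by grind) (by grind)] at hu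
    grind
  · exact key x x3 x4 x1 x2 hc

/-- A maximum intersecting family contains the star of some edge. -/
lemma IsIntersecting.exists_star_subset {k : ℕ} (hk : 4 ≤ k) (hV : Fintype.card V = 2 * k)
    (hsplit : HasSplitFactorization V) (hS : IsIntersecting S)
    (hcard : S.card = Nat.doubleFactorial (2 * k - 3)) :
    ∃ a b, a ≠ b ∧ ∀ π, FPFInvolution π → π a = b → π ∈ S := by
  suffices H : ∃ π e, FPFInvolution π ∧ e ∈ edgesOf π ∧
      ∀ ρ, FPFInvolution ρ → e ∈ edgesOf ρ → ρ ∈ S by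
    obtain ⟨π, _, hπ, ⟨a, rfl⟩, h⟩ := H
    exact ⟨a, π a, (hπ a).2.symm, fun ρ hρ hab => h ρ hρ (hρ.mk_mem_edgesOf.2 hab)⟩
  obtain ⟨π₀, hπ₀⟩ : S.Nonempty := by
    rw [← Finset.card_pos, hcard]
    exact Nat.doubleFactorial_pos _
  obtain ⟨ρ₀, hρ₀, -, hρ₀'⟩ := (hS.fpf _ hπ₀).exists_avoiding hk hV (X := ∅) (by simp) π₀
    (hS.fpf _ hπ₀) (by simp)
  have hρ₀S : ρ₀ ∉ S := fun hmem => by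
    obtain ⟨v, hv⟩ := hS.inter _ hmem _ hπ₀
    exact hρ₀' v (by simp) hv
  obtain ⟨e, g, heg, -⟩ := hS.exists_isPivot hk hV hsplit hcard hπ₀ hρ₀ hρ₀S
  obtain ⟨π, hπ, he, hg⟩ := heg.exists_mem
  have hπS := heg.mem π hπ he hg
  by_contra! hcon
  have other : ∀ e g, IsPivot S e g → e ∈ edgesOf π → ∃ h, h ≠ e ∧ IsPivot S g h := by
    intro e g heg he
    obtain ⟨ρ, hρ, heρ, hρS⟩ := hcon π e hπ he
    obtain ⟨p, q, hpq, hne⟩ := hS.exists_isPivot hk hV hsplit hcard hπS hρ hρS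
    obtain ⟨h1, h2⟩ := hne e he heρ
    rcases heg.inter hk hV hpq with h | h | h | h
    · exact absurd h h1
    · exact absurd h h2
    · exact ⟨q, h2.symm, h ▸ hpq⟩
    · exact ⟨p, h1.symm, h ▸ hpq.symm⟩
  obtain ⟨h, hhe, hgh⟩ := other e g heg he
  obtain ⟨h', hhg, heh⟩ := other g e heg.symm hg
  obtain rfl : h = h' := by
    rcases hgh.inter hk hV heh with h1 | h1 | h1 | h1
    · exact absurd h1.symm heg.ne
    · exact absurd h1.symm hhg
    · exact absurd h1 hhe
    · exact h1
  obtain ⟨ρ, hρ, hgρ, hhρ⟩ := hgh.exists_mem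
  obtain ⟨μ, hμ, heμ, hgμ, havoid⟩ := hπ.exists_avoiding_edges hk hV hρ he hg
  have hhμ : h ∉ edgesOf μ := fun hm => by
    rcases havoid h hm hhρ with h1 | h1
    · exact hhe h1
    · exact hgh.ne h1.symm
  obtain ⟨a, b, hab, hb, rfl, hbe, hg', hh'⟩ :=
    hμ.exists_switch_avoiding hk hV heμ hgμ heg.ne hhμ
  have hsw : switch a b μ ∉ S := fun hm => (hgh.mem_or _ hm).elim hg' hh'
  have hpiv := hS.isPivot_of_switch hk hV hsplit hcard hμ (heg.mem μ hμ heμ hgμ) hab hb hsw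
  rcases hpiv.inter hk hV heh with h1 | h1 | h1 | h1
  · exact heg.ne h1.symm
  · exact hgh.ne h1
  · exact hbe h1
  · exact hhμ (h1 ▸ ⟨b, rfl⟩)

end PerfectMatchings

section OneFactorizations

lemma IsOneFactorization.congr {V W C : Type*} [Fintype V] [Fintype W] [Fintype C]
    {F : C → Perm V} (hF : IsOneFactorization F) (e : V ≃ W) :
    IsOneFactorization fun c => e.permCongr (F c) where
  card := by rw [hF.card, Fintype.card_congr e]
  fpf c v := ⟨by simp [(hF.fpf c _).1], fun h => (hF.fpf c (e.symm v)).2 (by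
    simpa [Equiv.eq_symm_apply] using h)⟩
  inj c d v h := hF.inj c d (e.symm v) (by simpa using h)

lemma HasSplitFactorization.congr {V W : Type*} [Fintype V] [Fintype W]
    (h : HasSplitFactorization V) (e : V ≃ W) : HasSplitFactorization W := by
  obtain ⟨C, _, F, c, d, X, hF, hcd, hX, ⟨p, hp⟩, ⟨q, hq⟩⟩ := h
  refine ⟨C, inferInstance, _, c, d, e.symm ⁻¹' X, hF.congr e, hcd, fun v hv => ?_,
    ⟨e p, by simpa using hp⟩, ⟨e q, by simpa using hq⟩⟩
  simpa using hX _ hv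

lemma ZMod.two_mul_injective {m : ℕ} (hm : Odd m) {x y : ZMod m} (h : 2 * x = 2 * y) : x = y := by
  have h2 : IsUnit ((2 : ℕ) : ZMod m) :=
    (ZMod.isUnit_iff_coprime 2 m).2 (Nat.coprime_two_left.2 hm)
  exact h2.mul_left_cancel (by exact_mod_cast h)

/-- The standard one-factorization of the complete graph on `ℤ/m ∪ {∞}`, for odd `m`. -/
lemma exists_isOneFactorization_option {m : ℕ} [NeZero m] (hm : Odd m) :
    ∃ F : ZMod m → Perm (Option (ZMod m)), IsOneFactorization F := by
  let f : ZMod m → Option (ZMod m) → Option (ZMod m) := fun c v =>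
    v.elim (some c) fun x => if x = c then none else some (2 * c - x)
  have hne : ∀ c x : ZMod m, x ≠ c → 2 * c - x ≠ c := fun c x hx h => hx (by
    linear_combination -h)
  have hinv : ∀ c, Function.Involutive (f c) := by
    rintro c (_ | x)
    · simp [f]
    · by_cases hx : x = c
      · simp [f, hx]
      · simp [f, hx, hne c x hx]
  refine ⟨fun c => (hinv c).toPerm, by simp [Fintype.card_option], fun c v => ⟨hinv c v, ?_⟩, ?_⟩
  · rcases v with _ | x
    · simp [f]
    · by_cases hx : x = c
      · simp [f, hx]
      · have : 2 * c - x ≠ x := fun h =>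
          hx (ZMod.two_mul_injective hm (by linear_combination -h))
        simp [f, hx, this]
  · rintro c d (_ | x) h
    · simpa [f] using h
    · by_cases hc : x = c <;> by_cases hd : x = d <;> simp [f, hc, hd] at h
      · rw [← hc, ← hd]
      · simp [← hc, hd] at h
      · simp [← hd, hc] at h
      · exact ZMod.two_mul_injective hm (by linear_combination h)

/-- The perfect matching between two copies of `W` given by a permutation. -/
def crossPerm {W : Type*} (g : Perm W) : Perm (W × Bool) where
  toFun v := (bif v.2 then g.symm v.1 else g v.1, !v.2)
  invFun v := (bif v.2 then g.symm v.1 else g v.1, !v.2)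
  left_inv := by rintro ⟨x, _ | _⟩ <;> simp
  right_inv := by rintro ⟨x, _ | _⟩ <;> simp

lemma crossPerm_apply {W : Type*} (g : Perm W) (v : W × Bool) :
    crossPerm g v = (bif v.2 then g.symm v.1 else g v.1, !v.2) := rfl

lemma fpf_crossPerm {W : Type*} (g : Perm W) : FPFInvolution (crossPerm g) := by
  rintro ⟨x, _ | _⟩ <;> simp [crossPerm_apply]

lemma hasSplitFactorization_even {t : ℕ} (ht : 2 ≤ t) [NeZero (2 * t)] :
    HasSplitFactorization (ZMod (2 * t) × Bool) := by
  have : NeZero (2 * t - 1) := ⟨by omega⟩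
  obtain ⟨G₀, hG₀⟩ := exists_isOneFactorization_option (m := 2 * t - 1)
    (Nat.Even.sub_odd (by omega) (even_two_mul t) odd_one)
  have e : Option (ZMod (2 * t - 1)) ≃ ZMod (2 * t) := Fintype.equivOfCardEq (by
    simp only [Fintype.card_option, ZMod.card]; omega)
  have hG := hG₀.congr e
  set G : ZMod (2 * t - 1) → Perm (ZMod (2 * t)) := fun c => e.permCongr (G₀ c)
  let F : ZMod (2 * t - 1) ⊕ ZMod (2 * t) → Perm (ZMod (2 * t) × Bool) :=
    Sum.elim (fun c => (G c).prodCongr (Equiv.refl Bool)) fun j => crossPerm (Equiv.addRight j)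
  have htt : (t : ZMod (2 * t)) + t = 0 := by
    have := ZMod.natCast_self (2 * t)
    push_cast at this
    linear_combination this
  have ht0 : (t : ZMod (2 * t)) ≠ 0 := fun h => by
    have := Nat.le_of_dvd (by omega) ((ZMod.natCast_eq_zero_iff _ _).1 h)
    omega
  have h10 : (1 : ZMod (2 * t)) ≠ 0 := fun h => by
    have := Nat.le_of_dvd (by omega) ((ZMod.natCast_eq_zero_iff 1 (2 * t)).1 (by exact_mod_cast h))
    omega
  have h1t : (1 : ZMod (2 * t)) ≠ t := fun h => by
    have h' : ((t - 1 : ℕ) : ZMod (2 * t)) = 0 := by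
      rw [Nat.cast_sub (by omega), ← h]
      simp
    have := Nat.le_of_dvd (by omega) ((ZMod.natCast_eq_zero_iff _ _).1 h')
    omega
  refine ⟨_, inferInstance, F, Sum.inr 0, Sum.inr t, {v | v.1 = 0 ∨ v.1 = t}, ⟨?_, ?_, ?_⟩, ?_, ?_,
    ⟨(0, false), by simp⟩, ⟨(1, false), by simp [h10, h1t]⟩⟩
  · simp only [Fintype.card_sum, ZMod.card, Fintype.card_prod, Fintype.card_bool]
    omega
  · rintro (c | j)
    · rintro ⟨x, s⟩
      simp [F, (hG.fpf c x).1, (hG.fpf c x).2]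
    · exact fpf_crossPerm _
  · rintro (c | j) (d | j') ⟨x, s⟩ h
    · simp only [F, Sum.elim_inl, Equiv.prodCongr_apply, Prod.map_apply, Prod.mk.injEq] at h
      rw [hG.inj c d x h.1]
    · simp [F, crossPerm_apply] at h
    · simp [F, crossPerm_apply] at h
    · cases s <;> simpa [F, crossPerm_apply, sub_eq_add_neg] using h
  · simpa using ht0.symm
  · rintro ⟨x, s⟩ (rfl | rfl) <;> cases s <;>
      simp [F, crossPerm_apply, htt, neg_eq_of_add_eq_zero_left htt, -Equiv.addRight_zero]

lemma hasSplitFactorization_odd {k : ℕ} (hk : 5 ≤ k) (hodd : Odd k) [NeZero k] :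
    HasSplitFactorization (ZMod k × Bool) := by
  have hcast : ∀ n : ℕ, 0 < n → n < 5 → ((n : ℕ) : ZMod k) ≠ 0 := fun n h0 h5 h => by
    have := Nat.le_of_dvd h0 ((ZMod.natCast_eq_zero_iff _ _).1 h)
    omega
  have c1 : (1 : ZMod k) ≠ 0 := by simpa using hcast 1 (by omega) (by omega)
  have c2 : (2 : ZMod k) ≠ 0 := by simpa using hcast 2 (by omega) (by omega)
  have c3 : (3 : ZMod k) ≠ 0 := by simpa using hcast 3 (by omega) (by omega)
  have c4 : (4 : ZMod k) ≠ 0 := by simpa using hcast 4 (by omega) (by omega)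
  let φ : Perm (ZMod k) := swap (-1) (-2)
  have φ1 : φ 1 = 1 := swap_apply_of_ne_of_ne (fun h => c2 (by linear_combination h))
    (fun h => c3 (by linear_combination h))
  have φ2 : φ 2 = 2 := swap_apply_of_ne_of_ne (fun h => c3 (by linear_combination h))
    (fun h => c4 (by linear_combination h))
  have φ3 : φ (-1) = -2 := swap_apply_left _ _
  have φ4 : φ (-2) = -1 := swap_apply_right _ _
  have φs : φ.symm = φ := symm_swap _ _
  let g : ZMod k → Perm (ZMod k) := fun j => (φ.trans (Equiv.addRight j)).trans φ.symm
  have hg : ∀ j x, g j x = φ (φ x + j) := fun j x => by simp [g, φs]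
  have hgs : ∀ j x, (g j).symm x = φ (φ x - j) := fun j x => by
    simp [g, φs, sub_eq_add_neg]
  have hφφ : ∀ x, φ (φ x) = x := fun x => by
    simpa only [φs] using φ.symm_apply_apply x
  let f : ZMod k → ZMod k × Bool → ZMod k × Bool := fun i v =>
    if v.1 = i then (i, !v.2) else (2 * i - v.1, v.2)
  have hne : ∀ c x : ZMod k, x ≠ c → 2 * c - x ≠ c := fun c x hx h => hx (by
    linear_combination -h)
  have hinv : ∀ i, Function.Involutive (f i) := by
    rintro i ⟨x, s⟩
    by_cases hx : x = i
    · simp [f, hx]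
    · simp [f, hx, hne i x hx]
  let F : ZMod k ⊕ {j : ZMod k // j ≠ 0} → Perm (ZMod k × Bool) :=
    Sum.elim (fun i => (hinv i).toPerm) fun j => crossPerm (g j)
  have hmix : ∀ (i : ZMod k) (j : {j : ZMod k // j ≠ 0}) v,
      F (Sum.inl i) v ≠ F (Sum.inr j) v := by
    rintro i ⟨j, hj⟩ ⟨x, s⟩ h
    by_cases hx : x = i
    · cases s
      · simp only [F, f, hx, crossPerm_apply, Sum.elim_inl, Sum.elim_inr,
          Function.Involutive.coe_toPerm, if_true, Prod.mk.injEq, cond_false, and_true, hg] at h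
        have := congrArg φ h
        rw [hφφ] at this
        exact hj (by linear_combination -this)
      · simp only [F, f, hx, crossPerm_apply, Sum.elim_inl, Sum.elim_inr,
          Function.Involutive.coe_toPerm, if_true, Prod.mk.injEq, cond_true, and_true, hgs] at h
        have := congrArg φ h
        rw [hφφ] at this
        exact hj (by linear_combination this)
    · simp [F, f, hx, crossPerm_apply] at h
  refine ⟨_, inferInstance, F, Sum.inl 0, Sum.inr ⟨1, c1⟩,
    {v | v = (1, false) ∨ v = (-1, false) ∨ v = (2, true) ∨ v = (-2, true)}, ⟨?_, ?_, ?_⟩, ?_, ?_,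
    ⟨(1, false), by simp⟩, ⟨(0, false), by simp [c1, c1.symm]⟩⟩
  · rw [Fintype.card_sum, Fintype.card_subtype_compl, Fintype.card_subtype_eq, ZMod.card,
      Fintype.card_prod, ZMod.card, Fintype.card_bool]
    omega
  · rintro (i | j)
    · rintro ⟨x, s⟩
      refine ⟨hinv i _, ?_⟩
      by_cases hx : x = i
      · simp [F, f, hx]
      · have : 2 * i - x ≠ x := fun h =>
          hx (ZMod.two_mul_injective hodd (by linear_combination -h))
        simp [F, f, hx, this]
    · exact fpf_crossPerm _
  · rintro (i | j) (i' | j') ⟨x, s⟩ h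
    · by_cases hi : x = i <;> by_cases hi' : x = i' <;>
        simp only [F, f, hi, hi', Sum.elim_inl, Function.Involutive.coe_toPerm, if_true, if_false,
          Prod.mk.injEq] at h
      · rw [← hi, ← hi']
      · simp [← hi, hi'] at h
      · simp [← hi', hi] at h
      · rw [ZMod.two_mul_injective hodd (x := i) (y := i') (by linear_combination h.1)]
    · exact absurd h (hmix _ _ _)
    · exact absurd h.symm (hmix _ _ _)
    · cases s
      · simp only [F, crossPerm_apply, Sum.elim_inr, Prod.mk.injEq, cond_false, hg,
          and_true, φ.injective.eq_iff, add_right_inj] at h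
        rw [Subtype.ext h]
      · simp only [F, crossPerm_apply, Sum.elim_inr, Prod.mk.injEq, cond_true, hgs,
          and_true, φ.injective.eq_iff, sub_right_inj] at h
        rw [Subtype.ext h]
  · simp
  · have e1 : (-2 : ZMod k) + 1 = -1 := by ring
    have e2 : (1 : ZMod k) + 1 = 2 := by ring
    have e3 : (2 : ZMod k) - 1 = 1 := by ring
    have e4 : (-1 : ZMod k) - 1 = -2 := by ring
    rintro ⟨x, s⟩ (h | h | h | h) <;> obtain ⟨rfl, rfl⟩ := Prod.mk.inj h <;>
      simp [F, f, crossPerm_apply, hg, hgs, φ1, φ2, φ3, φ4, e1, e2, e3, e4, c1, c2]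

/-- For `k ≥ 4` the complete graph on `2 * k` vertices has a split one-factorization. -/
lemma hasSplitFactorization {k : ℕ} (hk : 4 ≤ k) {V : Type*} [Fintype V]
    (hV : Fintype.card V = 2 * k) : HasSplitFactorization V := by
  have : NeZero k := ⟨by omega⟩
  have e : ZMod k × Bool ≃ V := Fintype.equivOfCardEq (by simp [hV, mul_comm])
  refine HasSplitFactorization.congr ?_ e
  rcases Nat.even_or_odd k with h | h
  · obtain ⟨t, rfl⟩ := h.exists_two_nsmul
    exact hasSplitFactorization_even (by simp at hk; omega)
  · exact hasSplitFactorization_odd (by rcases h with ⟨t, rfl⟩; omega) h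

end OneFactorizations

section SmallCases

variable {V : Type*} [Fintype V]

lemma FPFInvolution.eq_of_agree_two (hV : Fintype.card V = 6) {π ρ : Perm V}
    (hπ : FPFInvolution π) (hρ : FPFInvolution ρ) {v w : V} (hv : π v = ρ v) (hw : π w = ρ w)
    (hwv : w ≠ v) (hwv' : w ≠ π v) : π = ρ := by
  ext x
  by_contra hx
  have h : [v, π v, w, π w, x, π x, ρ x].Nodup := by
    have h1 := hπ v; have h2 := hπ w; have h3 := hπ x
    have h4 := hρ v; have h5 := hρ w; have h6 := hρ x
    simp only [List.nodup_cons, List.mem_cons, List.not_mem_nil, or_false, not_or]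
    and_intros <;> grind
  have := h.length_le_card
  simp [hV] at this

lemma FPFInvolution.eq_of_agree_pairwise (hV : Fintype.card V = 6) {π ρ μ : Perm V}
    (hπ : FPFInvolution π) (hρ : FPFInvolution ρ) (hμ : FPFInvolution μ)
    (hne : π ≠ ρ) (hne' : π ≠ μ) {u v w : V} (hv : π v = ρ v) (hu : μ u = π u) (hw : μ w = ρ w) :
    μ v = π v := by
  by_contra hμv
  have huv : u ≠ v := fun h => hμv (h ▸ hu)
  have huv' : u ≠ π v := fun h => by grind [hμ v, hπ v, hμ u]
  have hwv : w ≠ v := by grind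
  have hwv' : w ≠ π v := by grind [hμ v, hπ v, hρ v, hμ w]
  by_cases hwu : w = u
  · exact hne (hπ.eq_of_agree_two hV hρ hv (w := u) (by grind) huv huv')
  by_cases hwu' : w = π u
  · exact hne (hπ.eq_of_agree_two hV hρ hv (w := w) (by grind [hπ u, hμ u]) hwv hwv')
  by_cases hwm : π w = μ w
  · exact hne' (hπ.eq_of_agree_two hV hμ hu.symm hwm hwu hwu')
  have h : [v, π v, u, π u, w, π w, μ w].Nodup := by
    have h1 := hπ v; have h2 := hπ w; have h3 := hπ u
    have h4 := hρ v; have h5 := hρ w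
    have h6 := hμ u; have h7 := hμ w
    simp only [List.nodup_cons, List.mem_cons, List.not_mem_nil, or_false, not_or]
    and_intros <;> grind
  have := h.length_le_card
  simp [hV] at this

variable [DecidableEq V] {S : Finset (Perm V)}

lemma IsIntersecting.exists_subset_star {k : ℕ} (hk : 2 ≤ k) (hk' : k < 4)
    (hV : Fintype.card V = 2 * k) (hS : IsIntersecting S)
    (hcard : S.card = Nat.doubleFactorial (2 * k - 3)) :
    ∃ a b, a ≠ b ∧ ∀ π ∈ S, π a = b := by
  obtain rfl | rfl : k = 2 ∨ k = 3 := by omega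
  · obtain ⟨π, rfl⟩ := Finset.card_eq_one.1 hcard
    have : Nonempty V := Fintype.card_pos_iff.1 (by omega)
    obtain ⟨a⟩ := this
    exact ⟨a, π a, ((hS.fpf π (by simp)) a).2.symm, by simp⟩
  · obtain ⟨π, ρ, μ, hπρ, hπμ, hρμ, rfl⟩ := Finset.card_eq_three.1 hcard
    have hπ := hS.fpf π (by simp)
    have hρ := hS.fpf ρ (by simp)
    have hμ := hS.fpf μ (by simp)
    obtain ⟨v, hv⟩ := hS.inter π (by simp) ρ (by simp)
    obtain ⟨u, hu⟩ := hS.inter μ (by simp) π (by simp)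
    obtain ⟨w, hw⟩ := hS.inter μ (by simp) ρ (by simp)
    refine ⟨v, π v, (hπ v).2.symm, ?_⟩
    simp [← hv, hπ.eq_of_agree_pairwise hV hρ hμ hπρ hπμ hv hu hw]

open Classical in
/-- The Erdős–Ko–Rado theorem for perfect matchings, in terms of involutions. -/
lemma IsIntersecting.exists_eq_star {k : ℕ} (hk : 2 ≤ k) (hV : Fintype.card V = 2 * k)
    (hS : IsIntersecting S) (hcard : S.card = Nat.doubleFactorial (2 * k - 3)) :
    ∃ a b, a ≠ b ∧ ∀ π, FPFInvolution π → (π ∈ S ↔ π a = b) := by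
  obtain ⟨a, b, hab, h⟩ : ∃ a b, a ≠ b ∧
      ((Finset.univ.filter fun π : Perm V => FPFInvolution π ∧ π a = b) = S) := by
    rcases lt_or_ge k 4 with h4 | h4
    · obtain ⟨a, b, hab, h⟩ := hS.exists_subset_star hk h4 hV hcard
      refine ⟨a, b, hab, (Finset.eq_of_subset_of_card_le (fun π hπ => ?_) ?_).symm⟩
      · simpa using ⟨hS.fpf π hπ, h π hπ⟩
      · rw [hcard]
        exact (FPFInvolution.card_eq_edge hk hV hab).le
    · obtain ⟨a, b, hab, h⟩ := hS.exists_star_subset h4 hV (hasSplitFactorization h4 hV) hcard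
      refine ⟨a, b, hab, Finset.eq_of_subset_of_card_le (fun π hπ => ?_) ?_⟩
      · obtain ⟨h1, h2⟩ := (Finset.mem_filter.1 hπ).2
        exact h π h1 h2
      · rw [hcard]
        exact (FPFInvolution.card_eq_edge hk hV hab).ge
  exact ⟨a, b, hab, fun π hπ => by simp [← h, hπ]⟩

end SmallCases

section Translation

lemma IsPM.exists_perm {k : ℕ} {M : Finset (Sym2 (Fin (2 * k)))} (hM : IsPM k M) :
    ∃ π : Perm (Fin (2 * k)), FPFInvolution π ∧ ∀ v w, s(v, w) ∈ M ↔ π v = w := by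
  have hex : ∀ v, ∃ w, s(v, w) ∈ M := fun v => by
    obtain ⟨e, ⟨he, hv⟩, -⟩ := hM.2 v
    obtain ⟨w, rfl⟩ := Sym2.mem_iff_exists.1 hv
    exact ⟨w, he⟩
  choose p hp using hex
  have huniq : ∀ v w, s(v, w) ∈ M → p v = w := fun v w h =>
    Sym2.congr_right.1 ((hM.2 v).unique ⟨hp v, Sym2.mem_mk_left _ _⟩ ⟨h, Sym2.mem_mk_left _ _⟩)
  have hinv : Function.Involutive p := fun v => huniq _ _ (Sym2.eq_swap ▸ hp v)
  refine ⟨hinv.toPerm, fun v => ⟨hinv v, fun h => hM.1 _ (hp v) ?_⟩,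
    fun v w => ⟨huniq v w, fun h => h ▸ hp v⟩⟩
  exact Eq.symm h

end Translation

/-- for `k ≥ 2`, any intersecting set of perfect matchings of
`K_{2k}` of size `(2k-3)!!` is canonical: it consists of all perfect matchings
containing some fixed edge `e` of `K_{2k}`. -/
theorem stmt_6 (k : ℕ) (hk : 2 ≤ k) (S : Finset (PM k))
    (hS : ∀ M ∈ S, ∀ N ∈ S, ∃ e, e ∈ M.1 ∧ e ∈ N.1)
    (hcard : S.card = Nat.doubleFactorial (2 * k - 3)) :
    ∃ e : Sym2 (Fin (2 * k)), ¬ e.IsDiag ∧ ∀ M : PM k, M ∈ S ↔ e ∈ M.1 := by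
  choose g hg hgM using fun M : PM k => M.2.exists_perm
  have hinj : Function.Injective g := fun M N h => Subtype.ext <| Finset.ext fun e => by
    induction e with | _ v w => rw [hgM, hgM, h]
  have hS' : IsIntersecting (S.map ⟨g, hinj⟩) := by
    constructor
    · simp only [Finset.mem_map, Function.Embedding.coeFn_mk]
      rintro _ ⟨M, -, rfl⟩
      exact hg M
    · simp only [Finset.mem_map, Function.Embedding.coeFn_mk]
      rintro _ ⟨M, hM, rfl⟩ _ ⟨N, hN, rfl⟩
      obtain ⟨e, heM, heN⟩ := hS M hM N hN
      induction e with
      | _ v w => exact ⟨v, ((hgM M v w).1 heM).trans ((hgM N v w).1 heN).symm⟩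
  obtain ⟨a, b, hab, h⟩ :=
    hS'.exists_eq_star hk (Fintype.card_fin _) ((Finset.card_map _).trans hcard)
  refine ⟨s(a, b), by simpa using hab, fun M => ?_⟩
  rw [hgM, ← h (g M) (hg M)]
  simp
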